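/- Let g be an n-Lie algebra over a field K of characteristic 0 with bracket π : ∧ⁿg → g. Then for every α ∈ C^p(g,g) with p ≥ 0, one has [π,α]^{nLie} = δ_g(α), where δ_g is the coboundary operator associated to the adjoint representation ad of g given by ad_{x₁,…,x_{n−1}}(y) = [x₁,…,x_{n−1},y]_g. -/

import Mathlib

open Finset

/-- The order-preserving inclusion `Fin (N-1) → Fin N` skipping the index `i`. -/
def skipIdx {N : ℕ} (i : Fin N) (s : Fin (N - 1)) : Fin N :=
  if (s : ℕ) < (i : ℕ) then ⟨s, by have h1 := s.isLt; omega⟩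
  else ⟨(s : ℕ) + 1, by have h1 := s.isLt; omega⟩

/-- `p`-cochains on `W` with values in `W` (blocks of `n-1` arguments, plus a final argument). -/
abbrev Cochain (W : Type*) (n p : ℕ) := (Fin p → (Fin (n - 1) → W)) → W → W

/-- The sign `(-1)^{(J,I)}` of the shuffle putting `J` before its complement. -/
def shuffleSign {N : ℕ} (J : Finset (Fin N)) : ℤ :=
  (-1) ^ ((∑ x ∈ J, (x : ℕ)) + ∑ a ∈ Finset.range J.card, a)

variable {W : Type*} [AddCommGroup W]

/-- The composition `α ∘ β` of cochains, given by the shuffle-sum insertion formula. -/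
def ncomp (n p q : ℕ) (α : Cochain W n p) (β : Cochain W n q) : Cochain W n (p + q) :=
  fun X z =>
    ∑ J ∈ Finset.powersetCard (q + 1) (Finset.univ : Finset (Fin (p + q + 1))),
      if hJ : J.card = q + 1 then
        (fun (eJ : Fin (q + 1) → Fin (p + q + 1)) (eI : Fin p → Fin (p + q + 1))
             (X' : Fin (p + q + 1) → Fin (n - 1) → W) =>
          shuffleSign J •
            (if (⟨p + q, by omega⟩ : Fin (p + q + 1)) ∈ J then
              ((-1 : ℤ) ^ p) • α (fun t => X' (eI t)) (β (fun a => X' (eJ a.castSucc)) z)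
            else
              ((-1 : ℤ) ^ ((Jᶜ.filter (fun i => i < eJ (Fin.last q))).card)) •
                ∑ s : Fin (n - 1),
                  α (fun t =>
                      if (t : ℕ) < (Jᶜ.filter (fun i => i < eJ (Fin.last q))).card then
                        X' (eI t)
                      else if (t : ℕ) = (Jᶜ.filter (fun i => i < eJ (Fin.last q))).card then
                        Function.update (X' (eJ (Fin.last q))) s
                          (β (fun a => X' (eJ a.castSucc)) (X' (eJ (Fin.last q)) s))
                      else X' (eI ⟨(t : ℕ) - 1, by have := t.isLt; omega⟩)) z))
          (fun a => J.orderEmbOfFin hJ a)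
          (fun t => Jᶜ.orderEmbOfFin (by rw [Finset.card_compl, hJ, Fintype.card_fin]; omega) t)
          (fun j => if h : (j : ℕ) < p + q then X ⟨j, h⟩ else 0)
      else 0

/-- The graded commutator bracket `[α,β] = (-1)^{pq} α∘β - β∘α`. -/
def nbracket (n p q : ℕ) (α : Cochain W n p) (β : Cochain W n q) : Cochain W n (p + q) :=
  fun X z => ((-1 : ℤ) ^ (p * q)) • ncomp n p q α β X z
    - ncomp n q p β α (fun i => X (Fin.cast (by omega : q + p = p + q) i)) z

/-- Append a final element to a block of `n-1` elements, giving an `n`-tuple. -/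
def tupSnoc {A : Type*} {n : ℕ} (X : Fin (n - 1) → A) (z : A) : Fin n → A :=
  fun t => if h : (t : ℕ) < n - 1 then X ⟨t, h⟩ else z

/-- Append a final element to `n-2` elements, giving an `(n-1)`-tuple. -/
def tupSnoc2 {A : Type*} {n : ℕ} (X : Fin (n - 2) → A) (z : A) : Fin (n - 1) → A :=
  fun t => if h : (t : ℕ) < n - 2 then X ⟨t, h⟩ else z

/-- From a block `y` of `n-1` elements, delete the entry at `s` and append `z`. -/
def hatSnoc {A : Type*} {n : ℕ} (y : Fin (n - 1) → A) (s : Fin (n - 1)) (z : A) :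
    Fin (n - 1) → A :=
  fun t => if h : (t : ℕ) < n - 2 then y (skipIdx s ⟨t, by omega⟩) else z

variable {K : Type*} [Field K] [CharZero K]
variable {g : Type*} [AddCommGroup g] [Module K g]
variable {V : Type*} [AddCommGroup V] [Module K V]

/-- The Fundamental (Filippov) Identity for an alternating `n`-multilinear bracket. -/
def FI {n : ℕ} (br : AlternatingMap K g g (Fin n)) : Prop :=
  ∀ (x : Fin (n - 1) → g) (y : Fin n → g),
    br (tupSnoc x (br y)) = ∑ i : Fin n, br (Function.update y i (br (tupSnoc x (y i))))

/-- An `n`-ary bracket viewed as a `1`-cochain. -/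
def toCochain {n : ℕ} (br : AlternatingMap K g g (Fin n)) : Cochain g n 1 :=
  fun X z => br (tupSnoc (X 0) z)

/-- The coboundary operator `δ_ρ` associated to a representation `ρ` of an `n`-Lie algebra. -/
def delta {n : ℕ} (p : ℕ) (br : AlternatingMap K g g (Fin n))
    (ρr : (Fin (n - 1) → g) → V → V)
    (α : (Fin p → (Fin (n - 1) → g)) → g → V) :
    (Fin (p + 1) → (Fin (n - 1) → g)) → g → V :=
  fun χ z =>
    (∑ i : Fin (p + 1), ∑ k : Fin (p + 1),
      if (i : ℕ) < (k : ℕ) then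
        ((-1 : ℤ) ^ ((i : ℕ) + 1)) • ∑ j : Fin (n - 1),
          α (fun t => if skipIdx i t = k
              then Function.update (χ k) j (br (tupSnoc (χ i) (χ k j)))
              else χ (skipIdx i t)) z
      else 0)
    + ∑ i : Fin (p + 1), ((-1 : ℤ) ^ ((i : ℕ) + 1)) •
        α (fun t => χ (skipIdx i t)) (br (tupSnoc (χ i) z))
    + ∑ i : Fin (p + 1), ((-1 : ℤ) ^ (i : ℕ)) •
        ρr (χ i) (α (fun t => χ (skipIdx i t)) z)
    + ∑ i : Fin (n - 1), ((-1 : ℤ) ^ (n + p + 1 - (i : ℕ))) •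
        ρr (fun s => if hs : (s : ℕ) < n - 2 then χ (Fin.last p) (skipIdx i ⟨s, by omega⟩) else z)
          (α (fun t => χ t.castSucc) (χ (Fin.last p) i))

/-- The `1`-cochain `π + ρ̄ + θ̄` on `g ⊕ V` built from the bracket and a generalized
representation. -/
def Dmap {n : ℕ} (br : AlternatingMap K g g (Fin n))
    (ρ : AlternatingMap K g (Module.End K V) (Fin (n - 1)))
    (θ : g →ₗ[K] (AlternatingMap K V V (Fin (n - 1)))) : Cochain (g × V) n 1 :=
  fun X z =>
    (br (fun t => (tupSnoc (X 0) z t).1),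
      (∑ i : Fin n, ((-1 : ℤ) ^ (n - 1 - (i : ℕ))) •
        ρ (fun s => (tupSnoc (X 0) z (skipIdx i s)).1) ((tupSnoc (X 0) z i).2))
      + ∑ i : Fin n, ((-1 : ℤ) ^ (n - 1 - (i : ℕ))) •
        θ ((tupSnoc (X 0) z i).1) (fun s => (tupSnoc (X 0) z (skipIdx i s)).2))

/-- `(V;ρ,θ)` is a generalized representation: `[π+ρ̄+θ̄, π+ρ̄+θ̄] = 0`. -/
def IsGenRep {n : ℕ} (br : AlternatingMap K g g (Fin n))
    (ρ : AlternatingMap K g (Module.End K V) (Fin (n - 1)))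
    (θ : g →ₗ[K] (AlternatingMap K V V (Fin (n - 1)))) : Prop :=
  ∀ X z, nbracket n 1 1 (Dmap br ρ θ) (Dmap br ρ θ) X z = 0

/-- A cochain on `g ⊕ V` is valued in `V`. -/
def ValuedInV {n p : ℕ} (α : Cochain (g × V) n p) : Prop := ∀ X z, (α X z).1 = 0

/-- A cochain on `g ⊕ V` vanishes when all arguments lie in `V`. -/
def VanishOnV {n p : ℕ} (α : Cochain (g × V) n p) : Prop :=
  ∀ (u : Fin p → Fin (n - 1) → V) (v : V),
    α (fun i s => ((0 : g), u i s)) ((0 : g), v) = 0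

/-- A cochain on `g` with values in `V`, extended to `g ⊕ V` (the summand inclusion
`C^p(g;V) ⊆ C^p_>(g⊕V,V)`). -/
def extGV {n p : ℕ} (α : (Fin p → (Fin (n - 1) → g)) → g → V) : Cochain (g × V) n p :=
  fun X z => (0, α (fun i s => (X i s).1) z.1)

/-- A linear map `g → V` viewed as a `1`-cochain in `C^0_>(g⊕V,V)`. -/
def ext0 {n : ℕ} (α : g →ₗ[K] V) : Cochain (g × V) n 0 := fun _ z => ((0 : g), α z.1)

/-- `β₃ ∈ Hom(∧ⁿ g, V)` viewed as a `2`-cochain in `C^1_>(g⊕V,V)`. -/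
def ext3 {n : ℕ} (β₃ : AlternatingMap K g V (Fin n)) : Cochain (g × V) n 1 :=
  fun X z => (0, β₃ (fun t => (tupSnoc (X 0) z t).1))

/-- `β₂ ∈ Hom(∧^{n-1} g ∧ V, V)` viewed as a `2`-cochain in `C^1_>(g⊕V,V)`. -/
def ext2 {n : ℕ} (β₂ : AlternatingMap K g (Module.End K V) (Fin (n - 1))) :
    Cochain (g × V) n 1 :=
  fun X z => (0, ∑ i : Fin n, ((-1 : ℤ) ^ (n - 1 - (i : ℕ))) •
    β₂ (fun s => (tupSnoc (X 0) z (skipIdx i s)).1) ((tupSnoc (X 0) z i).2))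

/-- The value of (the extension of) `β₁ ∈ Hom(∧^{n-1} V ∧ g, V)` on an `n`-tuple in `g ⊕ V`. -/
def ext1raw {n : ℕ} (β₁ : AlternatingMap K V (g →ₗ[K] V) (Fin (n - 1)))
    (w : Fin n → g × V) : V :=
  ∑ i : Fin n, ((-1 : ℤ) ^ (n - 1 - (i : ℕ))) • β₁ (fun s => (w (skipIdx i s)).2) ((w i).1)

/-- `β₁ ∈ Hom(∧^{n-1} V ∧ g, V)` viewed as a `2`-cochain in `C^1_>(g⊕V,V)`. -/
def ext1 {n : ℕ} (β₁ : AlternatingMap K V (g →ₗ[K] V) (Fin (n - 1))) :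
    Cochain (g × V) n 1 :=
  fun X z => (0, ext1raw β₁ (tupSnoc (X 0) z))

/-- A block of `g`-elements in `g ⊕ V`. -/
def gBlock {n : ℕ} (x : Fin (n - 1) → g) : Fin (n - 1) → g × V := fun s => (x s, 0)

/-- A block of `V`-elements in `g ⊕ V`. -/
def vBlock {n : ℕ} (u : Fin (n - 1) → V) : Fin (n - 1) → g × V := fun s => ((0 : g), u s)

/-- The contribution of the subset `J` to `ncomp`, with `J` and its complement enumerated by `eJ`
and `eI`. -/
def compTerm (n p q : ℕ) (α : Cochain W n p) (β : Cochain W n q)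
    (X : Fin (p + q) → Fin (n - 1) → W) (z : W) (J : Finset (Fin (p + q + 1)))
    (eJ : Fin (q + 1) → Fin (p + q + 1)) (eI : Fin p → Fin (p + q + 1)) : W :=
  (fun X' : Fin (p + q + 1) → Fin (n - 1) → W =>
    shuffleSign J •
      (if (⟨p + q, by omega⟩ : Fin (p + q + 1)) ∈ J then
        ((-1 : ℤ) ^ p) • α (fun t => X' (eI t)) (β (fun a => X' (eJ a.castSucc)) z)
      else
        ((-1 : ℤ) ^ ((Jᶜ.filter (fun i => i < eJ (Fin.last q))).card)) •
          ∑ s : Fin (n - 1),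
            α (fun t =>
                if (t : ℕ) < (Jᶜ.filter (fun i => i < eJ (Fin.last q))).card then
                  X' (eI t)
                else if (t : ℕ) = (Jᶜ.filter (fun i => i < eJ (Fin.last q))).card then
                  Function.update (X' (eJ (Fin.last q))) s
                    (β (fun a => X' (eJ a.castSucc)) (X' (eJ (Fin.last q)) s))
                else X' (eI ⟨(t : ℕ) - 1, by have := t.isLt; omega⟩)) z))
    (fun j => if h : (j : ℕ) < p + q then X ⟨j, h⟩ else 0)

theorem ncomp_eq_sum_compTerm {ι : Type*} (n p q : ℕ) (α : Cochain W n p) (β : Cochain W n q)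
    (X : Fin (p + q) → Fin (n - 1) → W) (z : W) (S : Finset ι)
    (J : ι → Finset (Fin (p + q + 1))) (eJ : ι → Fin (q + 1) → Fin (p + q + 1))
    (eI : ι → Fin p → Fin (p + q + 1))
    (hcard : ∀ i ∈ S, (J i).card = q + 1) (hinj : Set.InjOn J S)
    (hsurj : ∀ J' : Finset (Fin (p + q + 1)), J'.card = q + 1 → ∃ i ∈ S, J i = J')
    (hJ : ∀ i ∈ S, ∀ a, eJ i a ∈ J i) (hJmono : ∀ i ∈ S, StrictMono (eJ i))
    (hI : ∀ i ∈ S, ∀ a, eI i a ∉ J i) (hImono : ∀ i ∈ S, StrictMono (eI i)) :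
    ncomp n p q α β X z = ∑ i ∈ S, compTerm n p q α β X z (J i) (eJ i) (eI i) := by
  symm
  refine Finset.sum_bij (fun i _ => J i) ?_ ?_ ?_ ?_
  · intro i hi
    simp [Finset.mem_powersetCard, hcard i hi]
  · intro i hi j hj h
    exact hinj hi hj h
  · intro J' hJ'
    obtain ⟨i, hi, h⟩ := hsurj J' (Finset.mem_powersetCard.1 hJ').2
    exact ⟨i, hi, h⟩
  · intro i hi
    rw [dif_pos (hcard i hi)]
    have h1 := Finset.orderEmbOfFin_unique (hcard i hi) (hJ i hi) (hJmono i hi)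
    have h2 := Finset.orderEmbOfFin_unique
      (show (J i)ᶜ.card = p by rw [Finset.card_compl, hcard i hi, Fintype.card_fin]; omega)
      (fun a => Finset.mem_compl.2 (hI i hi a)) (hImono i hi)
    rw [h1, h2]
    rfl

/-- The increasing map `Fin p → Fin (p + 1 + 1)` skipping `i` and `k`, for `i < k`. -/
def skipPair {p : ℕ} (i k : Fin (p + 1 + 1)) (t : Fin p) : Fin (p + 1 + 1) :=
  ⟨if (t : ℕ) < i then t else if (t : ℕ) + 1 < k then t + 1 else t + 2, by
    have := t.isLt; split_ifs <;> omega⟩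

theorem ncomp_one_right (n p : ℕ) (α : Cochain W n p) (β : Cochain W n 1)
    (X : Fin (p + 1) → Fin (n - 1) → W) (z : W) :
    ncomp n p 1 α β X z = ∑ i : Fin (p + 1 + 1), ∑ k : Fin (p + 1 + 1),
      if i < k then compTerm n p 1 α β X z {i, k} ![i, k] (skipPair i k) else 0 := by
  have hsum := ncomp_eq_sum_compTerm n p 1 α β X z
    (Finset.univ.filter fun x : Fin (p + 1 + 1) × Fin (p + 1 + 1) => x.1 < x.2)
    (fun x => {x.1, x.2}) (fun x => ![x.1, x.2]) (fun x => skipPair x.1 x.2)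
    ?_ ?_ ?_ ?_ ?_ ?_ ?_
  · rw [hsum, Finset.sum_filter, Fintype.sum_prod_type]
  · rintro ⟨i, k⟩ h
    simp only [Finset.mem_filter, Finset.mem_univ, true_and] at h
    exact Finset.card_pair h.ne
  · rintro ⟨i, k⟩ h ⟨i', k'⟩ h' e
    simp only [Finset.coe_filter, Finset.mem_univ, true_and, Set.mem_ofPred_eq] at h h'
    have e1 : ∀ x, x = i ∨ x = k ↔ x = i' ∨ x = k' := fun x => by
      simpa using Finset.ext_iff.1 e x
    have a1 := (e1 i).1 (Or.inl rfl)
    have a2 := (e1 k).1 (Or.inr rfl)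
    ext <;> simp only [Fin.ext_iff, Fin.lt_def] at * <;> omega
  · intro J hJ
    obtain ⟨a, b, hab, rfl⟩ := Finset.card_eq_two.1 hJ
    rcases lt_or_gt_of_ne hab with h | h
    · exact ⟨(a, b), by simpa using h, rfl⟩
    · exact ⟨(b, a), by simpa using h, Finset.pair_comm _ _⟩
  · rintro ⟨i, k⟩ h a
    fin_cases a <;> simp
  · rintro ⟨i, k⟩ h
    simp only [Finset.mem_filter, Finset.mem_univ, true_and] at h
    intro a b hab
    fin_cases a <;> fin_cases b <;> simp_all
  · rintro ⟨i, k⟩ h a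
    simp only [Finset.mem_filter, Finset.mem_univ, true_and, Fin.lt_def] at h
    simp only [Finset.mem_insert, Finset.mem_singleton, Fin.ext_iff, skipPair]
    split_ifs <;> omega
  · rintro ⟨i, k⟩ h a b hab
    simp only [Finset.mem_filter, Finset.mem_univ, true_and, Fin.lt_def] at h hab
    simp only [Fin.lt_def, skipPair]
    split_ifs <;> omega

/-- The increasing map `Fin (p + 1) → Fin (1 + p + 1)` skipping `i`. -/
def skipOne {p : ℕ} (i : Fin (1 + p + 1)) (t : Fin (p + 1)) : Fin (1 + p + 1) :=
  ⟨if (t : ℕ) < i then t else t + 1, by have := t.isLt; split_ifs <;> omega⟩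

theorem ncomp_one_left (n p : ℕ) (α : Cochain W n 1) (β : Cochain W n p)
    (X : Fin (1 + p) → Fin (n - 1) → W) (z : W) :
    ncomp n 1 p α β X z = ∑ i : Fin (1 + p + 1),
      compTerm n 1 p α β X z {i}ᶜ (skipOne i) (fun _ => i) := by
  refine ncomp_eq_sum_compTerm n 1 p α β X z _ (fun i => {i}ᶜ) skipOne (fun i _ => i)
    ?_ ?_ ?_ ?_ ?_ ?_ ?_
  · intro i _
    rw [Finset.card_compl, Finset.card_singleton, Fintype.card_fin]
    omega
  · intro i _ j _ h
    simpa using h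
  · intro J hJ
    have : Jᶜ.card = 1 := by rw [Finset.card_compl, hJ, Fintype.card_fin]; omega
    obtain ⟨i, hi⟩ := Finset.card_eq_one.1 this
    exact ⟨i, Finset.mem_univ _, by simp [← hi]⟩
  · intro i _ a
    simp only [Finset.mem_compl, Finset.mem_singleton, Fin.ext_iff, skipOne]
    split_ifs <;> omega
  · intro i _ a b hab
    simp only [Fin.lt_def, skipOne] at *
    split_ifs <;> omega
  · simp
  · intro i _
    exact Subsingleton.strictMono _

theorem shuffleSign_pair {N : ℕ} {i k : Fin N} (h : i < k) :
    shuffleSign {i, k} = (-1) ^ ((i : ℕ) + k + 1) := by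
  simp [shuffleSign, Finset.card_pair h.ne, Finset.sum_pair h.ne, Finset.sum_range_succ]

theorem shuffleSign_compl_singleton {N : ℕ} (i : Fin (N + 1)) :
    shuffleSign ({i}ᶜ : Finset (Fin (N + 1))) = (-1) ^ (N + (i : ℕ)) := by
  have h1 := Finset.sum_compl_add_sum ({i} : Finset (Fin (N + 1))) (fun x => (x : ℕ))
  rw [Finset.sum_singleton, Fin.sum_univ_eq_sum_range (fun x => x), Finset.sum_range_succ] at h1
  unfold shuffleSign
  rw [Finset.card_compl, Finset.card_singleton, Fintype.card_fin, Nat.add_sub_cancel]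
  apply neg_one_pow_congr
  rw [Nat.even_iff, Nat.even_iff]
  omega

theorem card_filter_compl_pair {N : ℕ} {i k : Fin N} (h : i < k) :
    ((({i, k} : Finset (Fin N))ᶜ).filter (fun x => x < k)).card = k - 1 := by
  have : (({i, k} : Finset (Fin N))ᶜ).filter (fun x => x < k) = (Finset.Iio k).erase i := by
    ext x
    simp only [Finset.mem_filter, Finset.mem_compl, Finset.mem_insert, Finset.mem_singleton,
      Finset.mem_erase, Finset.mem_Iio, not_or]
    exact ⟨fun hx => ⟨hx.1.1, hx.2⟩, fun hx => ⟨⟨hx.1, hx.2.ne⟩, hx.2⟩⟩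
  rw [this, Finset.card_erase_of_mem (by simpa using h), Fin.card_Iio]

theorem compTerm_pair_last (n p : ℕ) (α : Cochain W n p) (β : Cochain W n 1)
    (X : Fin (p + 1) → Fin (n - 1) → W) (z : W) (i : Fin (p + 1)) :
    compTerm n p 1 α β X z {i.castSucc, Fin.last (p + 1)} ![i.castSucc, Fin.last (p + 1)]
        (skipPair i.castSucc (Fin.last (p + 1)))
      = ((-1 : ℤ) ^ (i : ℕ)) • α (fun t => X (skipIdx i t)) (β (fun _ => X i) z) := by
  unfold compTerm
  beta_reduce
  rw [shuffleSign_pair (Fin.castSucc_lt_last i), if_pos (by simp [Fin.ext_iff]), smul_smul,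
    ← pow_add]
  congr 1
  · apply neg_one_pow_congr
    simp only [Nat.even_iff, Fin.val_castSucc, Fin.val_last]
    omega
  · congr 1
    · funext t
      have := t.isLt
      simp only [skipPair, skipIdx, Fin.val_castSucc, Fin.val_last]
      split_ifs <;> first | rfl | (exfalso; omega)
    · congr 1
      funext a
      fin_cases a
      exact dif_pos i.isLt

theorem compTerm_pair_castSucc (n p : ℕ) (α : Cochain W n p) (β : Cochain W n 1)
    (X : Fin (p + 1) → Fin (n - 1) → W) (z : W) {i k : Fin (p + 1)} (h : i < k) :
    compTerm n p 1 α β X z {i.castSucc, k.castSucc} ![i.castSucc, k.castSucc]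
        (skipPair i.castSucc k.castSucc)
      = ((-1 : ℤ) ^ (i : ℕ)) • ∑ s : Fin (n - 1),
          α (fun t => if skipIdx i t = k
              then Function.update (X k) s (β (fun _ => X i) (X k s))
              else X (skipIdx i t)) z := by
  have h' : i.castSucc < k.castSucc := h
  have hlast : (![i.castSucc, k.castSucc] : Fin 2 → Fin (p + 1 + 1)) (Fin.last 1) = k.castSucc :=
    rfl
  have hlt : (i : ℕ) < k := h
  have hk := k.isLt
  unfold compTerm
  beta_reduce
  rw [shuffleSign_pair h', if_neg (by simp [Fin.ext_iff]; omega), smul_smul, ← pow_add]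
  simp only [hlast, card_filter_compl_pair h']
  congr 1
  · apply neg_one_pow_congr
    simp only [Nat.even_iff, Fin.val_castSucc]
    omega
  · refine Finset.sum_congr rfl fun s _ => ?_
    congr 1
    funext t
    have := t.isLt
    have hβ : (fun a : Fin 1 => if h : ((![i.castSucc, k.castSucc] : Fin 2 → Fin (p + 1 + 1))
        a.castSucc : ℕ) < p + 1 then X ⟨_, h⟩ else 0) = fun _ => X i := by
      funext a
      fin_cases a
      exact dif_pos i.isLt
    rw [hβ]
    have ht : skipIdx i t = k ↔ (t : ℕ) = k - 1 := by
      rw [skipIdx, Fin.ext_iff]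
      split_ifs <;> simp only <;> omega
    simp only [ht, Fin.val_castSucc, dif_pos hk]
    by_cases h1 : (t : ℕ) = k - 1
    · simp [h1]
    · rw [if_neg h1, if_neg h1]
      have hskip : (skipIdx i t : ℕ) = if (t : ℕ) < i then (t : ℕ) else t + 1 := by
        unfold skipIdx
        split_ifs <;> rfl
      have hX : ∀ j : Fin (p + 1 + 1), (j : ℕ) = skipIdx i t →
          (if h : (j : ℕ) < p + 1 then X ⟨j, h⟩ else 0) = X (skipIdx i t) := by
        intro j hj
        rw [dif_pos (by rw [hj]; exact (skipIdx i t).isLt)]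
        exact congrArg X (Fin.ext hj)
      by_cases h2 : (t : ℕ) < k - 1
      · rw [if_pos h2]
        apply hX
        rw [hskip]
        simp only [skipPair, Fin.val_castSucc]
        split_ifs <;> omega
      · rw [if_neg h2]
        apply hX
        rw [hskip]
        simp only [skipPair, Fin.val_castSucc]
        split_ifs <;> omega

theorem ncomp_toCochain_right {K : Type*} [Field K] {g : Type*} [AddCommGroup g] [Module K g]
    {n p : ℕ} (br : AlternatingMap K g g (Fin n)) (α : Cochain g n p)
    (χ : Fin (p + 1) → Fin (n - 1) → g) (z : g) :
    ncomp n p 1 α (toCochain br) χ z =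
      (∑ i : Fin (p + 1), ∑ k : Fin (p + 1),
        if (i : ℕ) < (k : ℕ) then
          ((-1 : ℤ) ^ (i : ℕ)) • ∑ j : Fin (n - 1),
            α (fun t => if skipIdx i t = k
                then Function.update (χ k) j (br (tupSnoc (χ i) (χ k j)))
                else χ (skipIdx i t)) z
        else 0)
      + ∑ i : Fin (p + 1), ((-1 : ℤ) ^ (i : ℕ)) •
          α (fun t => χ (skipIdx i t)) (br (tupSnoc (χ i) z)) := by
  rw [ncomp_one_right, Fin.sum_univ_castSucc]
  have h0 : ∀ k : Fin (p + 1 + 1), ¬ Fin.last (p + 1) < k := fun k => (Fin.le_last k).not_gt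
  simp only [h0, if_false, Finset.sum_const_zero, add_zero]
  rw [← Finset.sum_add_distrib]
  refine Finset.sum_congr rfl fun i _ => ?_
  rw [Fin.sum_univ_castSucc, if_pos (Fin.castSucc_lt_last i), compTerm_pair_last]
  congr 1
  refine Finset.sum_congr rfl fun k _ => ?_
  by_cases h : i < k
  · rw [if_pos (Fin.castSucc_lt_castSucc_iff.2 h), if_pos (show (i : ℕ) < k from h),
      compTerm_pair_castSucc n p α _ χ z h]
    rfl
  · rw [if_neg (fun h' => h (Fin.castSucc_lt_castSucc_iff.1 h')),
      if_neg (show ¬ (i : ℕ) < k from h)]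

/-- Replacing the entry `s` of a block by `a` agrees, up to sign, with deleting it and
appending `z` and `a`. -/
theorem map_tupSnoc_update {K : Type*} [Field K] {g : Type*} [AddCommGroup g] [Module K g]
    {n : ℕ} (br : AlternatingMap K g g (Fin n)) (y : Fin (n - 1) → g)
    (s : Fin (n - 1)) (a z : g) :
    br (tupSnoc (Function.update y s a) z) =
      ((-1 : ℤ) ^ (n - 1 - (s : ℕ))) • br (tupSnoc (hatSnoc y s z) a) := by
  obtain ⟨m, rfl⟩ : ∃ m, n = m + 1 := ⟨n - 1, by have := s.isLt; omega⟩
  have hs : (s : ℕ) < m := s.isLt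
  have hperm : tupSnoc (hatSnoc y s z) a =
      tupSnoc (Function.update y s a) z ∘ Fin.cycleIcc ⟨s, Nat.lt_succ_of_lt hs⟩ (Fin.last m) := by
    funext t
    have htm := t.isLt
    rw [Function.comp_apply]
    rcases lt_or_ge (t : ℕ) s with h | h
    · rw [Fin.cycleIcc_of_lt (show t < ⟨s, Nat.lt_succ_of_lt hs⟩ from h)]
      have h1 : (t : ℕ) < m := by omega
      have h2 : (t : ℕ) < m - 1 := by omega
      have h3 : (⟨t, h1⟩ : Fin m) ≠ s := by rw [Ne, Fin.ext_iff]; exact h.ne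
      simp [tupSnoc, hatSnoc, skipIdx, h1, h2, h, h3]
    · rcases Nat.lt_succ_iff_lt_or_eq.1 htm with h1 | h1
      · have hlast : t < Fin.last m := h1
        rw [Fin.cycleIcc_of_ge_of_lt (show ⟨s, Nat.lt_succ_of_lt hs⟩ ≤ t from h) hlast]
        have hval : ((t + 1 : Fin (m + 1)) : ℕ) = t + 1 := Fin.val_add_one_of_lt hlast
        have h4 : ¬ (t : ℕ) < s := by omega
        by_cases h2 : (t : ℕ) < m - 1
        · have h5 : (t : ℕ) + 1 < m := by omega
          have h3 : (⟨t + 1, h5⟩ : Fin m) ≠ s := by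
            rw [Ne, Fin.ext_iff]
            exact Nat.ne_of_gt (Nat.lt_succ_of_le h)
          simp [tupSnoc, hatSnoc, skipIdx, h1, h2, h4, h5, h3, hval]
        · have h5 : ¬ (t : ℕ) + 1 < m := by omega
          simp [tupSnoc, hatSnoc, h1, h2, h5, hval]
      · obtain rfl : t = Fin.last m := Fin.ext h1
        rw [Fin.cycleIcc_of_last (Fin.le_last _)]
        simp [tupSnoc, hs]
  rw [hperm, AlternatingMap.map_perm, Fin.sign_cycleIcc_of_le (Fin.le_last _), Units.smul_def,
    smul_smul]
  simp only [Fin.val_last, Nat.add_sub_cancel, Units.val_pow_eq_pow_val,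
    Units.val_neg, Units.val_one]
  rw [← pow_add, Even.neg_one_pow (Even.add_self _), one_smul]

theorem ncomp_toCochain_left {K : Type*} [Field K] {g : Type*} [AddCommGroup g] [Module K g]
    {n p : ℕ} (br : AlternatingMap K g g (Fin n)) (α : Cochain g n p)
    (χ : Fin (p + 1) → Fin (n - 1) → g) (z : g) :
    ncomp n 1 p (toCochain br) α (fun i => χ (Fin.cast (by omega : 1 + p = p + 1) i)) z =
      (∑ i : Fin (p + 1), ((-1 : ℤ) ^ (p + (i : ℕ))) •
        br (tupSnoc (χ i) (α (fun t => χ (skipIdx i t)) z)))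
      + ∑ s : Fin (n - 1), br (tupSnoc (Function.update (χ (Fin.last p)) s
          (α (fun t => χ t.castSucc) (χ (Fin.last p) s))) z) := by
  rw [ncomp_one_left, Fin.sum_univ_castSucc]
  congr 1
  · refine Fintype.sum_equiv (finCongr (by omega : 1 + p = p + 1)) _ _ fun i => ?_
    have hi := i.isLt
    unfold compTerm
    beta_reduce
    rw [shuffleSign_compl_singleton, if_pos (by simp [Fin.ext_iff]; omega), smul_smul, ← pow_add]
    congr 1
    · apply neg_one_pow_congr
      simp only [Nat.even_iff, Fin.val_castSucc, finCongr_apply, Fin.val_cast]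
      omega
    · simp only [toCochain, Fin.val_castSucc, dif_pos hi]
      congr 3
      funext t
      have := t.isLt
      simp only [skipOne, skipIdx, Fin.val_castSucc, finCongr_apply, Fin.val_cast]
      split_ifs <;> first | rfl | (exfalso; omega)
  · have hcard : ((({Fin.last (1 + p)}ᶜ : Finset (Fin (1 + p + 1)))ᶜ).filter
        (fun x => x < skipOne (Fin.last (1 + p)) (Fin.last p))).card = 0 := by
      rw [compl_compl, Finset.card_eq_zero, Finset.filter_eq_empty_iff]
      intro x hx
      rw [Finset.mem_singleton.1 hx]
      exact (Fin.le_last _).not_gt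
    unfold compTerm
    beta_reduce
    rw [shuffleSign_compl_singleton, if_neg (by simp [Fin.ext_iff]), hcard, pow_zero, one_smul,
      Even.neg_one_pow (by simp), one_smul]
    refine Finset.sum_congr rfl fun s _ => ?_
    have hX : (fun j : Fin (p + 1) =>
        if h : (skipOne (Fin.last (1 + p)) j : ℕ) < 1 + p then
          χ (Fin.cast (by omega : 1 + p = p + 1) ⟨_, h⟩) else 0) = χ := by
      funext j
      have := j.isLt
      have hj : (skipOne (Fin.last (1 + p)) j : ℕ) = j := by
        simp only [skipOne, Fin.val_last]
        exact if_pos (by omega)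
      rw [dif_pos (by omega)]
      congr 1
      exact Fin.ext hj
    have hX1 := fun j => congrFun hX j
    beta_reduce at hX1
    simp only [hX1]
    simp [toCochain]

/- STATEMENT 3 -/
theorem stmt3 (K : Type*) [Field K] [CharZero K] (g : Type*) [AddCommGroup g] [Module K g]
    (n : ℕ) (hn : 2 ≤ n) (br : AlternatingMap K g g (Fin n)) (hbr : FI br)
    (p : ℕ) (α : Cochain g n p) (χ : Fin (p + 1) → Fin (n - 1) → g) (z : g) :
    nbracket n 1 p (toCochain br) α (fun i => χ (Fin.cast (by omega : 1 + p = p + 1) i)) z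
      = delta p br (fun X v => br (tupSnoc X v)) α χ z := by
  have h4 : ∀ s : Fin (n - 1), ((-1 : ℤ) ^ p) • br (tupSnoc (Function.update (χ (Fin.last p)) s
      (α (fun t => χ t.castSucc) (χ (Fin.last p) s))) z) =
      ((-1 : ℤ) ^ (n + p + 1 - (s : ℕ))) • br (tupSnoc (hatSnoc (χ (Fin.last p)) s z)
        (α (fun t => χ t.castSucc) (χ (Fin.last p) s))) := by
    intro s
    have := s.isLt
    rw [map_tupSnoc_update, smul_smul, ← pow_add]
    congr 1
    apply neg_one_pow_congr
    rw [Nat.even_iff, Nat.even_iff]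
    omega
  unfold nbracket delta
  rw [ncomp_toCochain_left, one_mul, smul_add, Finset.smul_sum, Finset.smul_sum]
  simp only [h4]
  have h3 : ∀ i : Fin (p + 1), ((-1 : ℤ) ^ p) • ((-1 : ℤ) ^ (p + (i : ℕ))) •
      br (tupSnoc (χ i) (α (fun t => χ (skipIdx i t)) z)) =
      ((-1 : ℤ) ^ (i : ℕ)) • br (tupSnoc (χ i) (α (fun t => χ (skipIdx i t)) z)) := by
    intro i
    rw [smul_smul, ← pow_add]
    congr 1
    apply neg_one_pow_congr
    rw [Nat.even_iff, Nat.even_iff]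
    omega
  simp only [h3]
  have h12 := ncomp_toCochain_right br α χ z
  simp only [Fin.cast_cast, Fin.cast_eq_self]
  rw [h12]
  simp only [pow_succ (-1 : ℤ), mul_neg_one, neg_smul, Finset.sum_neg_distrib]
  have hneg : ∀ i k : Fin (p + 1), ∀ w : g,
      (if (i : ℕ) < k then -w else 0) = -(if (i : ℕ) < k then w else 0) := by
    intro i k w
    split_ifs <;> simp
  simp only [hneg, Finset.sum_neg_distrib]
  unfold hatSnoc
  abel
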